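/- There exists a finite constant C such that for all integers h ≥ 1 and k ≥ 0, if the chain Z starts at k then E[τ̃_h] < C·h. -/

import Mathlib

open MeasureTheory ProbabilityTheory
open scoped ENNReal

/-- ρ(i,j) := 2^{−i−j−1}·(i+j)!/(i!·j!). -/
noncomputable def rho (i j : ℕ) : ℝ :=
  (2 : ℝ) ^ (-(i : ℝ) - (j : ℝ) - 1) * (Nat.factorial (i + j)) /
    ((Nat.factorial i) * (Nat.factorial j))

/-- `Z` is a Markov chain with transition probabilities `trans` started at `k`:
`P(Z_0 = k) = 1` and
`P(Z_0 = k_0, …, Z_n = k_n) = P(Z_0 = k_0) · ∏_{0 ≤ i < n} trans(k_i, k_{i+1})`. -/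
def IsMarkovChainFrom {Ω : Type*} [MeasurableSpace Ω] (P : Measure Ω)
    (Z : ℕ → Ω → ℕ) (trans : ℕ → ℕ → ℝ) (k : ℕ) : Prop :=
  (∀ t, Measurable (Z t)) ∧
    ∀ (n : ℕ) (ks : ℕ → ℕ),
      P {ω | ∀ i ≤ n, Z i ω = ks i} =
        ENNReal.ofReal ((if ks 0 = k then 1 else 0) *
          ∏ i ∈ Finset.range n, trans (ks i) (ks (i + 1)))


/-- `Z̃_t := Z_t + Z_{t−1} + 1`. -/
def Ztil {Ω : Type*} (Z : ℕ → Ω → ℕ) (t : ℕ) (ω : Ω) : ℕ :=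
  Z t ω + Z (t - 1) ω + 1

/-- `τ̃_h := inf{t ≥ 1 : Z̃_t ≥ h}` (with value `∞` if there is no such `t`). -/
noncomputable def tauTil {Ω : Type*} (Z : ℕ → Ω → ℕ) (h : ℕ) (ω : Ω) : ℕ∞ :=
  sInf ((↑) '' {t : ℕ | 1 ≤ t ∧ h ≤ Ztil Z t ω} : Set ℕ∞)


lemma rho_eq_choose (i j : ℕ) :
    rho i j = (j + i).choose i * (1 / 2 : ℝ) ^ j * (1 / 2) ^ (i + 1) := by
  have h2 : (2 : ℝ) ^ (-(i : ℝ) - (j : ℝ) - 1) = (1 / 2 : ℝ) ^ j * (1 / 2) ^ (i + 1) := by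
    rw [show (-(i : ℝ) - (j : ℝ) - 1) = -((j + (i + 1) : ℕ) : ℝ) by push_cast; ring,
      Real.rpow_neg (by norm_num), Real.rpow_natCast, ← pow_add, one_div, inv_pow]
  rw [rho, h2, add_comm j i, Nat.choose_symm_add, Nat.add_choose, Nat.cast_div
    (Nat.factorial_mul_factorial_dvd_factorial_add i j) (by positivity)]
  push_cast
  ring

lemma rho_nonneg (i j : ℕ) : 0 ≤ rho i j := by
  rw [rho_eq_choose]
  positivity

lemma hasSum_rho (i : ℕ) : HasSum (fun j => rho i j) 1 := by
  have h := (hasSum_choose_mul_geometric_of_norm_lt_one (𝕜 := ℝ) i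
    (r := 1 / 2) (by norm_num)).mul_right ((1 / 2 : ℝ) ^ (i + 1))
  have h1 : 1 / (1 - (1 / 2 : ℝ)) ^ (i + 1) * (1 / 2) ^ (i + 1) = 1 := by
    rw [show (1 - 1 / 2 : ℝ) = 1 / 2 by norm_num]
    field_simp
  rw [h1] at h
  simpa only [rho_eq_choose] using h

lemma succ_mul_rho_succ (i j : ℕ) : ((j : ℝ) + 1) * rho i (j + 1) = (i + 1) * rho (i + 1) j := by
  have h : (j + 1) * (j + 1 + i).choose i = (i + 1) * (j + (i + 1)).choose (i + 1) := by
    have := Nat.choose_succ_right_eq (j + 1 + i) i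
    rw [show j + 1 + i - i = j + 1 by omega] at this
    rw [show j + (i + 1) = j + 1 + i by omega]
    linarith
  have h' : ((j : ℝ) + 1) * (j + 1 + i).choose i = (i + 1) * (j + (i + 1)).choose (i + 1) := by
    exact_mod_cast h
  rw [rho_eq_choose, rho_eq_choose]
  linear_combination ((1 / 2 : ℝ) ^ (j + 1) * (1 / 2) ^ (i + 1)) * h'

lemma hasSum_mul_rho (i : ℕ) : HasSum (fun j : ℕ => (j : ℝ) * rho i j) (i + 1) := by
  rw [← hasSum_nat_add_iff' 1]
  simpa [succ_mul_rho_succ] using (hasSum_rho (i + 1)).mul_left ((i : ℝ) + 1)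

lemma hasSum_sq_mul_rho (i : ℕ) :
    HasSum (fun j : ℕ => (j : ℝ) ^ 2 * rho i j) ((i + 1) * (i + 3)) := by
  rw [← hasSum_nat_add_iff' 1]
  have h := ((hasSum_mul_rho (i + 1)).add (hasSum_rho (i + 1))).mul_left ((i : ℝ) + 1)
  have hsum : ((i : ℝ) + 1) * ((i + 1 : ℕ) + 1 + 1) =
      (i + 1) * (i + 3) - ∑ j ∈ Finset.range 1, (j : ℝ) ^ 2 * rho i j := by
    rw [Finset.sum_range_one]
    push_cast
    ring
  refine hsum ▸ h.congr_fun fun j => ?_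
  push_cast
  linear_combination ((j : ℝ) + 1) * succ_mul_rho_succ i j

/-- The probability that the chain with transition probabilities `rho` started at `i` stays
below `h` up to time `n`. -/
noncomputable def survival (h : ℕ) : ℕ → ℕ → ℝ
  | 0, i => if i < h then 1 else 0
  | n + 1, i => if i < h then ∑ j ∈ Finset.range h, rho i j * survival h n j else 0

lemma survival_nonneg (h n i : ℕ) : 0 ≤ survival h n i := by
  induction n generalizing i with
  | zero => rw [survival]; split_ifs <;> norm_num
  | succ n ih =>
    rw [survival]
    split_ifs
    · exact Finset.sum_nonneg fun j _ => mul_nonneg (rho_nonneg i j) (ih j)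
    · rfl

lemma survival_eq_zero {h i : ℕ} (hi : h ≤ i) (n : ℕ) : survival h n i = 0 := by
  cases n <;> simp [survival, hi.not_gt]

/-- A nonnegative function decreasing by at least one in mean at each step of the chain from
a state below `h`. -/
noncomputable def lyapunov (h i : ℕ) : ℝ := 4 * h - 2 * i + (i : ℝ) ^ 2 / (4 * h)

lemma lyapunov_nonneg {h : ℕ} (hh : 1 ≤ h) (i : ℕ) : 0 ≤ lyapunov h i := by
  have hpos : (0 : ℝ) < h := by exact_mod_cast hh
  have : lyapunov h i = ((i : ℝ) - 4 * h) ^ 2 / (4 * h) := by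
    rw [lyapunov]
    field_simp
    ring
  rw [this]
  positivity

lemma lyapunov_le {h i : ℕ} (hi : i < h) : lyapunov h i ≤ 4 * h := by
  have hlt : (i : ℝ) < h := by exact_mod_cast hi
  have hpos : (0 : ℝ) < h := lt_of_le_of_lt (Nat.cast_nonneg i) hlt
  have : (i : ℝ) ^ 2 / (4 * h) ≤ 2 * i := by
    rw [div_le_iff₀ (by positivity)]
    nlinarith [(Nat.cast_nonneg i : (0 : ℝ) ≤ i)]
  rw [lyapunov]
  linarith

lemma sum_rho_mul_lyapunov_le {h i : ℕ} (hi : i < h) (s : Finset ℕ) :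
    ∑ j ∈ s, rho i j * lyapunov h j ≤ lyapunov h i - 1 := by
  have hle : (i : ℝ) + 1 ≤ h := by exact_mod_cast hi
  have hpos : (0 : ℝ) < h := by exact_mod_cast (Nat.zero_le i).trans_lt hi
  have hs : HasSum (fun j => rho i j * lyapunov h j)
      (4 * h * 1 - 2 * (i + 1) + 1 / (4 * h) * ((i + 1) * (i + 3))) := by
    refine ((((hasSum_rho i).mul_left (4 * (h : ℝ))).sub ((hasSum_mul_rho i).mul_left 2)).add
      ((hasSum_sq_mul_rho i).mul_left (1 / (4 * (h : ℝ))))).congr_fun fun j => ?_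
    rw [lyapunov]
    ring
  refine (sum_le_hasSum s (fun j _ => mul_nonneg (rho_nonneg i j)
    (lyapunov_nonneg (by omega) j)) hs).trans ?_
  have : 1 / (4 * (h : ℝ)) * (4 * i + 3) ≤ 1 := by
    rw [one_div_mul_eq_div, div_le_one (by positivity)]
    linarith
  rw [lyapunov]
  linear_combination this

lemma sum_survival_le_lyapunov {h : ℕ} (hh : 1 ≤ h) (n i : ℕ) :
    ∑ t ∈ Finset.range n, survival h t i ≤ lyapunov h i := by
  induction n generalizing i with
  | zero => simpa using lyapunov_nonneg hh i
  | succ n ih =>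
    rcases lt_or_ge i h with hi | hi
    · rw [Finset.sum_range_succ']
      simp only [survival, hi, if_true]
      rw [Finset.sum_comm]
      simp only [← Finset.mul_sum]
      have h1 := Finset.sum_le_sum fun j (_ : j ∈ Finset.range h) =>
        mul_le_mul_of_nonneg_left (ih j) (rho_nonneg i j)
      linarith [sum_rho_mul_lyapunov_le hi (Finset.range h)]
    · simpa [survival_eq_zero hi] using lyapunov_nonneg hh i

lemma sum_survival_le {h : ℕ} (hh : 1 ≤ h) (n i : ℕ) :
    ∑ t ∈ Finset.range n, survival h t i ≤ 4 * h := by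
  rcases lt_or_ge i h with hi | hi
  · exact (sum_survival_le_lyapunov hh n i).trans (lyapunov_le hi)
  · simp [survival_eq_zero hi]

section Chain

variable {Ω : Type*} [MeasurableSpace Ω] {P : Measure Ω} {Z : ℕ → Ω → ℕ} {k : ℕ}

lemma measure_path_inter_survive_le (hZ : IsMarkovChainFrom P Z rho k) (h m n : ℕ) (ks : ℕ → ℕ) :
    P {ω | (∀ i ≤ n, Z i ω = ks i) ∧ ∀ i ≤ m, Z (n + i) ω < h} ≤
      ENNReal.ofReal (((if ks 0 = k then 1 else 0) *
        ∏ i ∈ Finset.range n, rho (ks i) (ks (i + 1))) * survival h m (ks n)) := by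
  induction m generalizing n ks with
  | zero =>
    rcases lt_or_ge (ks n) h with hn | hn
    · rw [survival, if_pos hn, mul_one, ← hZ.2]
      exact measure_mono fun ω hω => hω.1
    · refine (measure_mono_null (t := ∅) ?_ measure_empty).trans_le zero_le
      rintro ω ⟨h1, h2⟩
      have := h2 0 le_rfl
      rw [add_zero, h1 n le_rfl] at this
      exact (this.not_ge hn).elim
  | succ m ih =>
    rcases lt_or_ge (ks n) h with hn | hn
    · have hsub : {ω | (∀ i ≤ n, Z i ω = ks i) ∧ ∀ i ≤ m + 1, Z (n + i) ω < h} ⊆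
          ⋃ j ∈ Finset.range h, {ω | (∀ i ≤ n + 1, Z i ω = Function.update ks (n + 1) j i) ∧
            ∀ i ≤ m, Z (n + 1 + i) ω < h} := by
        rintro ω ⟨h1, h2⟩
        simp only [Set.mem_iUnion, Finset.mem_range]
        refine ⟨Z (n + 1) ω, h2 1 (by omega), fun i hi => ?_, fun i hi => ?_⟩
        · rcases eq_or_ne i (n + 1) with rfl | hne
          · simp
          · rw [Function.update_of_ne hne, h1 i (by omega)]
        · rw [add_assoc]
          exact h2 (1 + i) (by omega)
      refine (measure_mono hsub).trans ((measure_biUnion_finset_le _ _).trans ?_)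
      refine (Finset.sum_le_sum fun j _ => ih (n + 1) (Function.update ks (n + 1) j)).trans ?_
      have hprod (j : ℕ) : ∏ i ∈ Finset.range (n + 1), rho (Function.update ks (n + 1) j i)
          (Function.update ks (n + 1) j (i + 1)) =
          (∏ i ∈ Finset.range n, rho (ks i) (ks (i + 1))) * rho (ks n) j := by
        rw [Finset.prod_range_succ, Function.update_self, Function.update_of_ne (by omega)]
        congr 1
        refine Finset.prod_congr rfl fun i hi => ?_
        have := Finset.mem_range.mp hi
        rw [Function.update_of_ne (by omega), Function.update_of_ne (by omega)]
      simp only [hprod, Function.update_self, Function.update_of_ne (Nat.succ_ne_zero n).symm]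
      have hp : 0 ≤ (if ks 0 = k then (1 : ℝ) else 0) *
          ∏ i ∈ Finset.range n, rho (ks i) (ks (i + 1)) :=
        mul_nonneg (by split_ifs <;> norm_num) (Finset.prod_nonneg fun i _ => rho_nonneg _ _)
      rw [← ENNReal.ofReal_sum_of_nonneg]
      · refine le_of_eq (congrArg _ ?_)
        rw [survival, if_pos hn, Finset.mul_sum]
        exact Finset.sum_congr rfl fun j _ => by ring
      · intro j _
        rw [← mul_assoc]
        exact mul_nonneg (mul_nonneg hp (rho_nonneg _ _)) (survival_nonneg _ _ _)
    · refine (measure_mono_null (t := ∅) ?_ measure_empty).trans_le zero_le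
      rintro ω ⟨h1, h2⟩
      have := h2 0 (Nat.zero_le _)
      rw [add_zero, h1 n le_rfl] at this
      exact (this.not_ge hn).elim

lemma measure_survive_le [IsProbabilityMeasure P] (hZ : IsMarkovChainFrom P Z rho k) (h m : ℕ) :
    P {ω | ∀ i ≤ m, Z i ω < h} ≤ ENNReal.ofReal (survival h m k) := by
  have h0 : P {ω | Z 0 ω = k} = 1 := by simpa using hZ.2 0 fun _ => k
  have hae : ∀ᵐ ω ∂P, Z 0 ω = k :=
    (prob_compl_eq_zero_iff (measurableSet_eq_fun (hZ.1 0) measurable_const)).mpr h0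
  have h1 := measure_path_inter_survive_le hZ h m 0 fun _ => k
  simp only [Finset.range_zero, Finset.prod_empty, if_true, one_mul, zero_add] at h1
  refine (measure_mono_ae ?_).trans h1
  filter_upwards [hae] with ω hω hs
  refine ⟨fun i hi => ?_, hs⟩
  obtain rfl : i = 0 := by omega
  exact hω

end Chain

lemma tauTil_le {Ω : Type*} {Z : ℕ → Ω → ℕ} {h t : ℕ} {ω : Ω} (ht : h ≤ Z t ω) :
    tauTil Z h ω ≤ (t + 1 : ℕ) :=
  sInf_le ⟨t + 1, ⟨by omega, by simp only [Ztil, Nat.add_sub_cancel]; omega⟩, rfl⟩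

lemma tauTil_le_one_add_tsum {Ω : Type*} (Z : ℕ → Ω → ℕ) (h : ℕ) (ω : Ω) :
    ((tauTil Z h ω : ℕ∞) : ℝ≥0∞) ≤
      1 + ∑' t, {ω | ∀ i ≤ t, Z i ω < h}.indicator (fun _ => (1 : ℝ≥0∞)) ω := by
  classical
  by_cases hex : ∃ t, h ≤ Z t ω
  · have hsum := ENNReal.sum_le_tsum
      (f := fun t => {ω | ∀ i ≤ t, Z i ω < h}.indicator (fun _ => (1 : ℝ≥0∞)) ω)
      (Finset.range (Nat.find hex))
    rw [Finset.sum_congr rfl (g := fun _ => (1 : ℝ≥0∞))] at hsum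
    · have h1 : ((tauTil Z h ω : ℕ∞) : ℝ≥0∞) ≤ (((Nat.find hex + 1 : ℕ) : ℕ∞) : ℝ≥0∞) :=
        ENat.toENNReal_le.mpr (tauTil_le (Nat.find_spec hex))
      refine h1.trans ?_
      rw [ENat.toENNReal_coe, Nat.cast_add, Nat.cast_one, add_comm]
      gcongr
      simpa using hsum
    · intro t ht
      refine Set.indicator_of_mem (fun i hi => ?_) _
      have := Finset.mem_range.mp ht
      exact not_le.mp (Nat.find_min hex (by omega))
  · push Not at hex
    simp [Set.indicator, hex]

/-- There exists a finite constant C such that for all integers h ≥ 1 and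
k ≥ 0, if the chain Z starts at k then E[τ̃_h] < C·h. -/
theorem stmt_10 :
    ∃ C : ℝ,
      ∀ (h k : ℕ), 1 ≤ h →
        ∀ (Ω : Type) (_ : MeasurableSpace Ω) (P : Measure Ω) (Z : ℕ → Ω → ℕ),
          IsProbabilityMeasure P → IsMarkovChainFrom P Z rho k →
          ∫⁻ ω, ((tauTil Z h ω : ℕ∞) : ℝ≥0∞) ∂P < ENNReal.ofReal (C * h) := by
  refine ⟨6, fun h k hh Ω _ P Z _ hZ => ?_⟩
  have hmeas (t : ℕ) : MeasurableSet {ω | ∀ i ≤ t, Z i ω < h} := by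
    simp only [Set.ofPred_forall]
    exact MeasurableSet.iInter fun i => MeasurableSet.iInter fun _ =>
      measurableSet_lt (hZ.1 i) measurable_const
  have hh' : (1 : ℝ) ≤ h := by exact_mod_cast hh
  calc ∫⁻ ω, ((tauTil Z h ω : ℕ∞) : ℝ≥0∞) ∂P
      ≤ ∫⁻ ω, (1 + ∑' t, {ω | ∀ i ≤ t, Z i ω < h}.indicator (fun _ => (1 : ℝ≥0∞)) ω) ∂P :=
        lintegral_mono fun ω => tauTil_le_one_add_tsum Z h ω
    _ = 1 + ∑' t, P {ω | ∀ i ≤ t, Z i ω < h} := by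
        rw [lintegral_add_left measurable_const,
          lintegral_tsum fun t => (measurable_const.indicator (hmeas t)).aemeasurable]
        simp [lintegral_indicator_const (hmeas _)]
    _ ≤ 1 + ENNReal.ofReal (4 * h) := by
        gcongr
        refine ENNReal.tsum_le_of_sum_range_le fun n => ?_
        refine (Finset.sum_le_sum fun t _ => measure_survive_le hZ h t).trans ?_
        rw [← ENNReal.ofReal_sum_of_nonneg fun t _ => survival_nonneg h t k]
        exact ENNReal.ofReal_le_ofReal (sum_survival_le hh n k)
    _ = ENNReal.ofReal (1 + 4 * h) := by
        rw [ENNReal.ofReal_add zero_le_one (by positivity), ENNReal.ofReal_one]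
    _ < ENNReal.ofReal (6 * h) :=
        (ENNReal.ofReal_lt_ofReal_iff (by positivity)).mpr (by linarith)
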